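/- arXiv:1811.07142 — 5 statements merged into one kernel-verified Lean document; each statement's English description precedes it below -/
import Mathlib

section
/- Let Var be a finite set with a wildcard element *, let G be a set of named gaps over Var, and suppose G is good (i.e., B-good for some B ∈ ℕ). Then the order ⊴ restricted to G is a well-quasi-order on G. -/
universe u v w

/-- A gap quadruple `(lw, ls, uw, us)` with `lw, ls ∈ ℕ` and `uw, us ∈ ℕ ∪ {∞}`. -/
structure GapVal where
  lw : ℕ
  ls : ℕ
  uw : ℕ∞
  us : ℕ∞

/-- Well-formedness of a gap quadruple: either both upper bounds are finite,
or both are `∞`. -/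
def GapVal.WF (g : GapVal) : Prop :=
  (g.uw ≠ ⊤ ∧ g.us ≠ ⊤) ∨ (g.uw = ⊤ ∧ g.us = ⊤)

/-- A named gap over `Var`: a variable together with either `nreg`
(modelled by `none`) or a gap quadruple. -/
abbrev NamedGap (Var : Type u) := Var × Option GapVal

/-- A gap quadruple is free if both its upper bounds are `∞`. -/
def GapVal.Free (g : GapVal) : Prop := g.uw = ⊤ ∧ g.us = ⊤

/-- A gap quadruple is `B`-gap-bounded if both its upper bounds are at most `B`. -/
def GapVal.Bounded (B : ℕ) (g : GapVal) : Prop := g.uw ≤ (B : ℕ∞) ∧ g.us ≤ (B : ℕ∞)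

/-- The order `⊴` on named gaps, where `star` is the wildcard element of `Var`. -/
def gapLe {Var : Type u} (star : Var) (a b : NamedGap Var) : Prop :=
  (a.1 ≠ b.1 → a.1 = star) ∧
  (a.2 = none ↔ b.2 = none) ∧
  ∀ v v' : GapVal, a.2 = some v → b.2 = some v' →
    v.lw ≤ v'.lw ∧ v.ls ≤ v'.ls ∧ v'.uw ≤ v.uw ∧ v'.us ≤ v.us

/-- A set of named gaps is `B`-good if each of its elements carrying a gap
quadruple is free or `B`-gap-bounded. -/
def GoodSet {Var : Type u} (B : ℕ) (G : Set (NamedGap Var)) : Prop :=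
  ∀ g ∈ G, ∀ v : GapVal, g.2 = some v → v.Free ∨ v.Bounded B

/-- `r` is a well-quasi-order on the subset `S`: every infinite sequence of
elements of `S` contains indices `i < j` with `r (f i) (f j)`. -/
def IsWQOOn {α : Type u} (S : Set α) (r : α → α → Prop) : Prop :=
  ∀ f : ℕ → α, (∀ n, f n ∈ S) → ∃ i j, i < j ∧ r (f i) (f j)

/-- A task state of dimension `K`. -/
abbrev TaskState (UnrSuff : Type u) (Var : Type v) (K : ℕ) :=
  UnrSuff × (Fin K → NamedGap Var)

/-- The order `≼` on task states, where `starU` and `star` are the wildcard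
elements of `UnrSuff` and `Var` respectively. -/
def taskLe {UnrSuff : Type u} {Var : Type v} (starU : UnrSuff) (star : Var) {K : ℕ}
    (a b : TaskState UnrSuff Var K) : Prop :=
  (a.1 ≠ b.1 → a.1 = starU) ∧ ∀ k, gapLe star (a.2 k) (b.2 k)

/-- `A ∀∃≼ B`: every element of `A` is `r`-below some element of `B`. -/
def forallExists {α : Type u} (r : α → α → Prop) (A B : Multiset α) : Prop :=
  ∀ a ∈ A, ∃ b ∈ B, r a b

/-- `A ∃∀≼ B`: every element of `B` is `r`-above some element of `A`. -/
def existsForall {α : Type u} (r : α → α → Prop) (A B : Multiset α) : Prop :=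
  ∀ b ∈ B, ∃ a ∈ A, r a b

/-- A configuration: finite sets of tasks and phasers (modelled as finite sets
of naturals), a Boolean valuation, control sequences, and phases.  In a phase
`(var, some (w, s))`, `w` is the wait value and `s` the signal value, while
`(var, none)` means the task is not registered to the phaser. -/
structure Config (BV : Type u) (Var : Type v) (UnrSuff : Type w) where
  T : Finset ℕ
  P : Finset ℕ
  bv : BV → Bool
  seq : ℕ → UnrSuff
  phase : ℕ → ℕ → Var × Option (ℕ × ℕ)

/-- A constraint: finite sets of tasks and phasers, a Boolean valuation with
wildcard (`none` is `*`), control sequences, named gaps, and environment gaps. -/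
structure Constraint (BV : Type u) (Var : Type v) (UnrSuff : Type w) where
  T : Finset ℕ
  P : Finset ℕ
  bv : BV → Option Bool
  seq : ℕ → UnrSuff
  gap : ℕ → ℕ → NamedGap Var
  egap : ℕ → ℕ × ℕ

/-- `c ⊨ φ`: the configuration `c` is denoted by the constraint `φ`.
The inequalities `lw ≤ l − w ≤ uw` and `ls ≤ s − l ≤ us` are rendered
additively (`w + lw ≤ l`, etc.) to avoid truncated subtraction issues. -/
def Denotes {BV : Type u} {Var : Type v} {UnrSuff : Type w} (star : Var) (starU : UnrSuff)
    (φ : Constraint BV Var UnrSuff) (c : Config BV Var UnrSuff) : Prop :=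
  (∀ b, φ.bv b ≠ some (c.bv b) → φ.bv b = none) ∧
  ∃ T1 ⊆ c.T, ∃ P1 ⊆ c.P, ∃ τ : ℕ → ℕ, ∃ π : ℕ → ℕ,
    T1.image τ = φ.T ∧ Set.InjOn π ↑P1 ∧ P1.image π = φ.P ∧
    (∀ t ∈ T1, φ.seq (τ t) ≠ c.seq t → φ.seq (τ t) = starU) ∧
    ∀ p ∈ P1, ∃ l : ℕ,
      (∀ t ∈ T1,
        ((c.phase t p).1 ≠ (φ.gap (τ t) (π p)).1 → (φ.gap (τ t) (π p)).1 = star) ∧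
        ((c.phase t p).2 = none ↔ (φ.gap (τ t) (π p)).2 = none) ∧
        (∀ w s : ℕ, ∀ v : GapVal, (c.phase t p).2 = some (w, s) →
          (φ.gap (τ t) (π p)).2 = some v →
          w + v.lw ≤ l ∧ ((l - w : ℕ) : ℕ∞) ≤ v.uw ∧
          l + v.ls ≤ s ∧ ((s - l : ℕ) : ℕ∞) ≤ v.us)) ∧
      (∀ t ∈ c.T, t ∉ T1 → ∀ w s : ℕ, (c.phase t p).2 = some (w, s) →
        w + (φ.egap (π p)).1 ≤ l ∧ l + (φ.egap (π p)).2 ≤ s)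

/-- The denotation `⟦φ⟧` of a constraint. -/
def Denotation {BV : Type u} {Var : Type v} {UnrSuff : Type w} (star : Var) (starU : UnrSuff)
    (φ : Constraint BV Var UnrSuff) : Set (Config BV Var UnrSuff) :=
  {c | Denotes star starU φ c}

/-- `φa ⊑ φb`: the constraint `φa` is entailed by the constraint `φb`. -/
def Entails {BV : Type u} {Var : Type v} {UnrSuff : Type w} (star : Var) (starU : UnrSuff)
    (φa φb : Constraint BV Var UnrSuff) : Prop :=
  (∀ b, φa.bv b ≠ φb.bv b → φa.bv b = none) ∧
  ∃ T1 ⊆ φb.T, ∃ P1 ⊆ φb.P, ∃ τ : ℕ → ℕ, ∃ π : ℕ → ℕ,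
    T1.image τ = φa.T ∧ Set.InjOn π ↑P1 ∧ P1.image π = φa.P ∧
    (∀ t ∈ T1, φa.seq (τ t) ≠ φb.seq t → φa.seq (τ t) = starU) ∧
    ∀ p ∈ P1,
      ((φa.egap (π p)).1 ≤ (φb.egap p).1 ∧ (φa.egap (π p)).2 ≤ (φb.egap p).2) ∧
      (∀ t ∈ T1, gapLe star (φa.gap (τ t) (π p)) (φb.gap t p)) ∧
      (∀ t ∈ φb.T, t ∉ T1 → ∀ v : GapVal, (φb.gap t p).2 = some v →
        (φa.egap (π p)).1 ≤ v.lw ∧ (φa.egap (π p)).2 ≤ v.ls)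

/-- A constraint is `B`-good if all the named gaps of its tasks/phasers
carrying a quadruple are free or `B`-gap-bounded. -/
def ConstraintBGood {BV : Type u} {Var : Type v} {UnrSuff : Type w} (B : ℕ)
    (φ : Constraint BV Var UnrSuff) : Prop :=
  ∀ t ∈ φ.T, ∀ p ∈ φ.P, ∀ v : GapVal, (φ.gap t p).2 = some v → v.Free ∨ v.Bounded B

/-- An encoding of a constraint: `L` task indices, `M` phaser indices. -/
structure Encoding (BV : Type u) (Var : Type v) (UnrSuff : Type w) where
  L : ℕ
  M : ℕ
  bv : BV → Option Bool
  acc : Fin L → UnrSuff × (Fin M → NamedGap Var)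
  env : Fin M → ℕ × ℕ

/-- `e` enumerates the finite set `S` (this corresponds to choosing a total
order on `S`, the element of index `i` being `e i`). -/
def IsEnum (S : Finset ℕ) (e : Fin S.card → ℕ) : Prop :=
  Function.Injective e ∧ ∀ i, e i ∈ S

/-- The encoding `⌈φ⌉` of a constraint `φ` with respect to enumerations
(total orders) `eT` of its tasks and `eP` of its phasers. -/
def encodingOf {BV : Type u} {Var : Type v} {UnrSuff : Type w}
    (φ : Constraint BV Var UnrSuff)
    (eT : Fin φ.T.card → ℕ) (eP : Fin φ.P.card → ℕ) : Encoding BV Var UnrSuff where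
  L := φ.T.card
  M := φ.P.card
  bv := φ.bv
  acc := fun i => (φ.seq (eT i), fun j => φ.gap (eT i) (eP j))
  env := fun j => φ.egap (eP j)

/-- The entailment relation `⊑ₑ` on encodings. -/
def EncEntails {BV : Type u} {Var : Type v} {UnrSuff : Type w} (star : Var) (starU : UnrSuff)
    (e e' : Encoding BV Var UnrSuff) : Prop :=
  (∀ b, e.bv b ≠ e'.bv b → e.bv b = none) ∧
  ∃ hM : e.M = e'.M, ∃ h : Fin e'.L → Fin e.L, Function.Surjective h ∧
    (∀ i : Fin e'.L,
      ((e.acc (h i)).1 ≠ (e'.acc i).1 → (e.acc (h i)).1 = starU) ∧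
      ∀ j : Fin e.M, gapLe star ((e.acc (h i)).2 j) ((e'.acc i).2 (Fin.cast hM j))) ∧
    (∀ j : Fin e.M, (e.env j).1 ≤ (e'.env (Fin.cast hM j)).1 ∧
      (e.env j).2 ≤ (e'.env (Fin.cast hM j)).2)

/-- An encoding is `B`-good if every named gap occurring in it and carrying a
quadruple is free or `B`-gap-bounded. -/
def EncodingBGood {BV : Type u} {Var : Type v} {UnrSuff : Type w} (B : ℕ)
    (e : Encoding BV Var UnrSuff) : Prop :=
  ∀ (i : Fin e.L) (j : Fin e.M) (v : GapVal),
    ((e.acc i).2 j).2 = some v → v.Free ∨ v.Bounded B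

/-- The variable of a named gap together with its upper bounds, if any. -/
def NamedGap.upper {Var : Type u} (g : NamedGap Var) : Var × Option (ℕ∞ × ℕ∞) :=
  (g.1, g.2.map fun v => (v.uw, v.us))

/-- The lower bounds of a named gap, with value `0` for `nreg`. -/
def NamedGap.lower {Var : Type u} (g : NamedGap Var) : ℕ × ℕ :=
  g.2.elim 0 fun v => (v.lw, v.ls)

theorem gapLe_of_upper_eq_of_lower_le {Var : Type u} (star : Var) {a b : NamedGap Var}
    (hu : NamedGap.upper a = NamedGap.upper b) (hl : NamedGap.lower a ≤ NamedGap.lower b) :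
    gapLe star a b := by
  obtain ⟨x, _ | v⟩ := a <;> obtain ⟨y, _ | v'⟩ := b <;>
    simp_all [gapLe, NamedGap.upper, NamedGap.lower, Prod.le_def]

theorem GoodSet.finite_image_upper {Var : Type u} [Finite Var] {B : ℕ}
    {G : Set (NamedGap Var)} (hG : GoodSet B G) : (NamedGap.upper '' G).Finite := by
  have hT : (insert ⊤ (Set.Iic (B : ℕ∞))).Finite :=
    (Set.Finite.subset ((Set.finite_Iic B).image ((↑) : ℕ → ℕ∞)) fun x hx => by
      obtain ⟨n, rfl⟩ := ENat.ne_top_iff_exists.1 (ne_top_of_le_ne_top (ENat.natCast_ne_top B) hx)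
      exact ⟨n, by simpa using hx, rfl⟩).insert ⊤
  refine (Set.finite_univ.prod (((hT.prod hT).image some).insert none)).subset ?_
  rintro _ ⟨⟨x, _ | v⟩, hg, rfl⟩
  · simp [NamedGap.upper]
  · obtain ⟨h₁, h₂⟩ | ⟨h₁, h₂⟩ := hG _ hg v rfl <;> simp [NamedGap.upper, h₁, h₂]

/-- A good set of named gaps is well-quasi-ordered by `⊴`. -/
theorem goodSet_isWQO_gapLe {Var : Type u} [Fintype Var] (star : Var)
    (G : Set (NamedGap Var)) (hG : ∃ B : ℕ, GoodSet B G) :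
    IsWQOOn G (gapLe star) := by
  obtain ⟨B, hG⟩ := hG
  intro f hf
  have hU : (NamedGap.upper '' G).PartiallyWellOrderedOn (· = ·) :=
    hG.finite_image_upper.partiallyWellOrderedOn
  obtain ⟨g, hg⟩ := hU.exists_monotone_subseq fun n => Set.mem_image_of_mem _ (hf n)
  obtain ⟨i, j, hij, hl⟩ :=
    wellQuasiOrdered_le (α := ℕ × ℕ) fun n => NamedGap.lower (f (g n))
  exact ⟨g i, g j, g.strictMono hij, gapLe_of_upper_eq_of_lower_le star (hg i j hij.le) hl⟩
end

section
/- Let Var and UnrSuff be finite sets each containing a wildcard element *, let K ∈ ℕ, and let G be a good set of named gaps over Var. Then the set of task states UnrSuff × G^K is well-quasi-ordered by the order ≼. -/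
universe u v w

/-- The lower bounds of a named gap, with value `(0, 0)` at `nreg`. -/
def NamedGap.lowerPart {Var : Type u} (g : NamedGap Var) : ℕ × ℕ :=
  g.2.elim (0, 0) fun v => (v.lw, v.ls)

/-- The variable of a named gap together with its upper bounds, if any. -/
def NamedGap.upperPart {Var : Type u} (g : NamedGap Var) : Var × Option (ℕ∞ × ℕ∞) :=
  (g.1, g.2.map fun v => (v.uw, v.us))

theorem gapLe_of_upperPart_eq {Var : Type u} (star : Var) {a b : NamedGap Var}
    (hu : NamedGap.upperPart a = NamedGap.upperPart b)
    (hl : NamedGap.lowerPart a ≤ NamedGap.lowerPart b) :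
    gapLe star a b := by
  obtain ⟨x, _ | v⟩ := a <;> obtain ⟨y, _ | v'⟩ := b <;>
    simp_all [gapLe, NamedGap.upperPart, NamedGap.lowerPart]

theorem GoodSet.finite_image_upperPart {Var : Type u} [Finite Var] {B : ℕ}
    {G : Set (NamedGap Var)} (hG : GoodSet B G) : (NamedGap.upperPart '' G).Finite := by
  have hF : (insert ⊤ ((↑) '' Set.Iic B) : Set ℕ∞).Finite :=
    ((Set.finite_Iic B).image _).insert _
  have hmem : ∀ x : ℕ∞, x ≤ B → x ∈ (insert ⊤ ((↑) '' Set.Iic B) : Set ℕ∞) := by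
    intro x hx
    lift x to ℕ using ne_top_of_le_ne_top (ENat.natCast_ne_top B) hx
    exact Or.inr ⟨x, by exact_mod_cast hx, rfl⟩
  refine (Set.finite_univ.prod (((hF.prod hF).image some).insert none)).subset ?_
  rintro _ ⟨⟨x, _ | v⟩, hg, rfl⟩
  · exact ⟨trivial, Or.inl rfl⟩
  · refine ⟨trivial, Or.inr ⟨(v.uw, v.us), ?_, rfl⟩⟩
    rcases hG _ hg v rfl with h | h
    · exact ⟨Or.inl h.1, Or.inl h.2⟩
    · exact ⟨hmem _ h.1, hmem _ h.2⟩

/-- Task states over a good set of named gaps are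
well-quasi-ordered by `≼`. -/
theorem taskStates_isWQO {Var : Type u} {UnrSuff : Type v}
    [Fintype Var] [Fintype UnrSuff] (star : Var) (starU : UnrSuff) (K : ℕ)
    (G : Set (NamedGap Var)) (hG : ∃ B : ℕ, GoodSet B G) :
    IsWQOOn {a : TaskState UnrSuff Var K | ∀ k, a.2 k ∈ G} (taskLe starU star) := by
  obtain ⟨B, hB⟩ := hG
  intro f hf
  have : Finite (NamedGap.upperPart '' G) := hB.finite_image_upperPart
  have hwqo := (Finite.wellQuasiOrdered
      ((· = ·) : UnrSuff × (Fin K → NamedGap.upperPart '' G) → _ → Prop)).prod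
    (wellQuasiOrdered_le (α := Fin K → ℕ × ℕ))
  obtain ⟨i, j, hij, heq, hle⟩ := hwqo fun n =>
    (((f n).1, fun k => ⟨NamedGap.upperPart ((f n).2 k), (f n).2 k, hf n k, rfl⟩),
      fun k => NamedGap.lowerPart ((f n).2 k))
  obtain ⟨hs, hu⟩ := Prod.ext_iff.mp heq
  exact ⟨i, j, hij, fun h => absurd hs h, fun k =>
    gapLe_of_upperPart_eq star (congrArg Subtype.val (congrFun hu k)) (hle k)⟩
end

section
/- Let Var and UnrSuff be finite sets each containing a wildcard element *, let K ∈ ℕ, and let G be a good set of named gaps over Var. Then the set of finite multisets over UnrSuff × G^K is well-quasi-ordered by the relation ∀∃≼. -/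
universe u v w

theorem List.SublistForall₂.exists_rel_of_mem {α β : Type*} {r : α → β → Prop}
    {l₁ : List α} {l₂ : List β} (h : List.SublistForall₂ r l₁ l₂) {a : α} (ha : a ∈ l₁) :
    ∃ b ∈ l₂, r a b := by
  induction h with
  | nil => simp at ha
  | cons hab _ ih =>
    rcases List.mem_cons.1 ha with rfl | ha
    · exact ⟨_, List.mem_cons_self, hab⟩
    · obtain ⟨b, hb, h⟩ := ih ha
      exact ⟨b, List.mem_cons_of_mem _ hb, h⟩
  | cons_right _ ih =>
    obtain ⟨b, hb, h⟩ := ih ha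
    exact ⟨b, List.mem_cons_of_mem _ hb, h⟩

theorem Set.PartiallyWellOrderedOn.of_mapsTo {α β : Type*} {r : α → α → Prop}
    {r' : β → β → Prop} {s : Set α} {t : Set β} (ht : t.PartiallyWellOrderedOn r') {f : α → β}
    (hf : Set.MapsTo f s t) (h : ∀ a b, r' (f a) (f b) → r a b) :
    s.PartiallyWellOrderedOn r := by
  rw [Set.partiallyWellOrderedOn_iff_exists_lt]
  intro g hg
  obtain ⟨m, n, hmn, hr⟩ := ht.exists_lt fun n => hf (hg n)
  exact ⟨m, n, hmn, h _ _ hr⟩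

instance gapLe.isPreorder {Var : Type*} (star : Var) : IsPreorder (NamedGap Var) (gapLe star) where
  refl a := ⟨fun h => absurd rfl h, Iff.rfl, fun v v' h h' => by
    obtain rfl : v = v' := Option.some.inj (h.symm.trans h')
    exact ⟨le_rfl, le_rfl, le_rfl, le_rfl⟩⟩
  trans a b c := by
    rintro ⟨h1, h2, h3⟩ ⟨h1', h2', h3'⟩
    refine ⟨by grind, h2.trans h2', fun v v'' hv hv'' => ?_⟩
    obtain ⟨v', hv'⟩ : ∃ v', b.2 = some v' :=
      Option.ne_none_iff_exists'.1 fun h => by simp [h2.2 h] at hv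
    obtain ⟨p1, p2, p3, p4⟩ := h3 v v' hv hv'
    obtain ⟨q1, q2, q3, q4⟩ := h3' v' v'' hv' hv''
    exact ⟨p1.trans q1, p2.trans q2, q3.trans p3, q4.trans p4⟩

instance taskLe.isPreorder {UnrSuff Var : Type*} (starU : UnrSuff) (star : Var) (K : ℕ) :
    IsPreorder (TaskState UnrSuff Var K) (taskLe starU star) where
  refl a := ⟨fun h => absurd rfl h, fun k => refl_of (gapLe star) (a.2 k)⟩
  trans a b c hab hbc := ⟨by have := hab.1; have := hbc.1; grind,
    fun k => trans_of (gapLe star) (hab.2 k) (hbc.2 k)⟩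

/-- The components of a named gap that take finitely many values on a good set (variable and upper
bounds), paired with its lower bounds, which are `0` for `nreg`. -/
def NamedGap.split {Var : Type*} (g : NamedGap Var) : (Var × Option (ℕ∞ × ℕ∞)) × (ℕ × ℕ) :=
  ((g.1, g.2.map fun v => (v.uw, v.us)), (g.2.map fun v => (v.lw, v.ls)).getD 0)

theorem gapLe_of_split {Var : Type*} (star : Var) {a b : NamedGap Var}
    (h₁ : a.split.1 = b.split.1) (h₂ : a.split.2 ≤ b.split.2) : gapLe star a b := by
  obtain ⟨x, _ | v⟩ := a <;> obtain ⟨y, _ | w⟩ := b <;>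
    simp_all [NamedGap.split, gapLe, Prod.le_def]

theorem partiallyWellOrderedOn_gapLe {Var : Type*} [Finite Var] (star : Var) {B : ℕ}
    {G : Set (NamedGap Var)} (hG : GoodSet B G) : G.PartiallyWellOrderedOn (gapLe star) := by
  let U : Set ℕ∞ := insert ⊤ ((↑) '' Set.Iic B)
  have hU : U.Finite := ((Set.finite_Iic B).image _).insert _
  have mem_U {x : ℕ∞} (hx : x ≤ B) : x ∈ U := by
    lift x to ℕ using ne_top_of_le_ne_top (ENat.natCast_ne_top B) hx
    exact Or.inr ⟨x, by simpa using hx, rfl⟩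
  let F : Set (Var × Option (ℕ∞ × ℕ∞)) := Set.univ ×ˢ insert none (some '' U ×ˢ U)
  have hF : F.Finite := Set.finite_univ.prod (((hU.prod hU).image _).insert _)
  have hP : (F ×ˢ (Set.univ : Set (ℕ × ℕ))).PartiallyWellOrderedOn
      fun x y => x.1 = y.1 ∧ x.2 ≤ y.2 :=
    hF.partiallyWellOrderedOn.prod
      (Set.partiallyWellOrderedOn_univ_iff.2 wellQuasiOrdered_le)
  refine hP.of_mapsTo (f := NamedGap.split) ?_ fun a b h => gapLe_of_split star h.1 h.2
  rintro ⟨x, _ | v⟩ hg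
  · simp [NamedGap.split, F]
  · have hv : v.uw ∈ U ∧ v.us ∈ U := by
      rcases hG _ hg v rfl with ⟨h, h'⟩ | ⟨h, h'⟩
      · exact ⟨Or.inl h, Or.inl h'⟩
      · exact ⟨mem_U h, mem_U h'⟩
    simpa [NamedGap.split, F] using hv

theorem partiallyWellOrderedOn_taskLe {UnrSuff Var : Type*} [Finite UnrSuff] (starU : UnrSuff)
    (star : Var) (K : ℕ) {G : Set (NamedGap Var)} (hG : G.PartiallyWellOrderedOn (gapLe star)) :
    {a : TaskState UnrSuff Var K | ∀ k, a.2 k ∈ G}.PartiallyWellOrderedOn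
      (taskLe starU star) := by
  have hU : (Set.univ : Set UnrSuff).PartiallyWellOrderedOn (· = ·) :=
    Set.finite_univ.partiallyWellOrderedOn
  refine (hU.prod (Set.PartiallyWellOrderedOn.pi fun _ : Fin K => hG)).of_mapsTo (f := id) ?_
    fun a b h => ⟨fun hne => absurd h.1 hne, h.2⟩
  exact fun a ha => ⟨trivial, fun k _ => ha k⟩

/-- Finite multisets of task states over a good set of named gaps
are well-quasi-ordered by `∀∃≼`. -/
theorem multisets_isWQO_forallExists {Var : Type u} {UnrSuff : Type v}
    [Fintype Var] [Fintype UnrSuff] (star : Var) (starU : UnrSuff) (K : ℕ)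
    (G : Set (NamedGap Var)) (hG : ∃ B : ℕ, GoodSet B G) :
    IsWQOOn {m : Multiset (TaskState UnrSuff Var K) | ∀ a ∈ m, ∀ k, a.2 k ∈ G}
      (forallExists (taskLe starU star)) := by
  obtain ⟨B, hB⟩ := hG
  have hS := (partiallyWellOrderedOn_taskLe starU star K
    (partiallyWellOrderedOn_gapLe star hB)).partiallyWellOrderedOn_sublistForall₂
  intro f hf
  obtain ⟨i, j, hij, h⟩ := hS.exists_lt (f := fun n => (f n).toList)
    fun n x hx => hf n x (Multiset.mem_toList.1 hx)
  refine ⟨i, j, hij, fun a ha => ?_⟩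
  obtain ⟨b, hb, hab⟩ := h.exists_rel_of_mem (Multiset.mem_toList.2 ha)
  exact ⟨b, Multiset.mem_toList.1 hb, hab⟩
end

section
/- Let Var and UnrSuff be finite sets each containing a wildcard element *, let K ∈ ℕ, and let G be a good set of named gaps over Var. Every infinite sequence a₁, a₂, … of task states in UnrSuff × G^K admits an infinite subsequence a_{i₁}, a_{i₂}, … such that: (i) a_{i₁} ≼ a_{i₂} ≼ a_{i₃} ≼ … ; (ii) all elements of the subsequence have the same UnrSuff component; and (iii) for each coordinate k ∈ {1, …, K}, the sequence of k-th gap components along the subsequence is either constant, or strictly increasing in ⊴ (i.e., for all indices l < m the k-th component of a_{i_l} is ⊴-below that of a_{i_m} but not conversely). -/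
universe u v w

theorem exists_strictMono_comp_eq_of_finite_range {α : Type*} (f : ℕ → α)
    (hf : (Set.range f).Finite) :
    ∃ φ : ℕ → ℕ, StrictMono φ ∧ ∀ l m, f (φ l) = f (φ m) := by
  obtain ⟨φ, hφ⟩ := (hf.partiallyWellOrderedOn (r := Eq)).exists_monotone_subseq
    (f := f) (fun n => Set.mem_range_self n)
  refine ⟨φ, φ.strictMono, fun l m => ?_⟩
  rcases le_total l m with h | h
  · exact hφ l m h
  · exact (hφ m l h).symm

theorem exists_strictMono_comp_const_or_strictMono {α : Type*} [PartialOrder α]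
    [WellQuasiOrderedLE α] (f : ℕ → α) :
    ∃ φ : ℕ → ℕ, StrictMono φ ∧ ((∀ l m, f (φ l) = f (φ m)) ∨ StrictMono (f ∘ φ)) := by
  obtain ⟨φ, hφ⟩ := (wellQuasiOrdered_le (α := α)).exists_monotone_subseq f
  obtain ⟨ψ, hψ⟩ := exists_increasing_or_nonincreasing_subseq (· < ·) (f ∘ φ)
  refine ⟨φ ∘ ψ, φ.strictMono.comp ψ.strictMono, ?_⟩
  rcases hψ with h | h
  · exact Or.inr fun l m hlm => h l m hlm
  · have key : ∀ l m, l < m → f (φ (ψ l)) = f (φ (ψ m)) := fun l m hlm =>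
      (hφ _ _ (ψ.strictMono hlm).le).eq_of_not_lt (h l m hlm)
    refine Or.inl fun l m => ?_
    rcases lt_trichotomy l m with hlm | rfl | hlm
    · exact key l m hlm
    · rfl
    · exact (key m l hlm).symm

/-- Finitely many properties of subsequences that are inherited by further subsequences can be
achieved simultaneously if each of them can be achieved by refining any given subsequence. -/
theorem exists_strictMono_forall_of_hereditary {ι : Type*} [Finite ι]
    (P : ι → (ℕ → ℕ) → Prop)
    (hered : ∀ k φ (ψ : ℕ → ℕ), StrictMono ψ → P k φ → P k (φ ∘ ψ))
    (refine_subseq : ∀ k φ, ∃ ψ : ℕ → ℕ, StrictMono ψ ∧ P k (φ ∘ ψ))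
    (φ₀ : ℕ → ℕ) :
    ∃ ψ : ℕ → ℕ, StrictMono ψ ∧ ∀ k, P k (φ₀ ∘ ψ) := by
  classical
  have := Fintype.ofFinite ι
  suffices h : ∀ s : Finset ι, ∃ ψ : ℕ → ℕ, StrictMono ψ ∧ ∀ k ∈ s, P k (φ₀ ∘ ψ) by
    simpa using h Finset.univ
  intro s
  induction s using Finset.induction_on with
  | empty => exact ⟨id, strictMono_id, by simp⟩
  | insert k s _ ih =>
    obtain ⟨ψ, hψ, hP⟩ := ih
    obtain ⟨χ, hχ, hk⟩ := refine_subseq k (φ₀ ∘ ψ)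
    refine ⟨ψ ∘ χ, hψ.comp hχ, fun j hj => ?_⟩
    rcases Finset.mem_insert.mp hj with rfl | hj
    · exact hk
    · exact hered j (φ₀ ∘ ψ) χ hχ (hP j hj)

/-- The variable and the upper bounds of a named gap. -/
def NamedGap.shape {Var : Type u} (g : NamedGap Var) : Var × Option (ℕ∞ × ℕ∞) :=
  (g.1, g.2.map fun v => (v.uw, v.us))

theorem NamedGap.ext_of_shape_lower {Var : Type u} {g h : NamedGap Var}
    (hs : NamedGap.shape g = NamedGap.shape h) (hl : NamedGap.lower g = NamedGap.lower h) :
    g = h := by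
  obtain ⟨x, _ | ⟨a, b, c, d⟩⟩ := g <;> obtain ⟨y, _ | ⟨a', b', c', d'⟩⟩ := h <;>
    simp_all [NamedGap.shape, NamedGap.lower]

theorem gapLe_iff_lower_le {Var : Type u} (star : Var) {g h : NamedGap Var}
    (hs : NamedGap.shape g = NamedGap.shape h) :
    gapLe star g h ↔ NamedGap.lower g ≤ NamedGap.lower h := by
  obtain ⟨x, _ | ⟨a, b, c, d⟩⟩ := g <;> obtain ⟨y, _ | ⟨a', b', c', d'⟩⟩ := h <;>
    simp_all [NamedGap.shape, NamedGap.lower, gapLe]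

theorem gapLe_refl {Var : Type u} (star : Var) (g : NamedGap Var) : gapLe star g g :=
  (gapLe_iff_lower_le star rfl).2 le_rfl

theorem GoodSet.finite_image_shape {Var : Type u} [Finite Var] {B : ℕ}
    {G : Set (NamedGap Var)} (hG : GoodSet B G) : (NamedGap.shape '' G).Finite := by
  have hB : (Set.Iic (B : ℕ∞)).Finite := by
    refine ((Set.finite_Iic B).image ((↑) : ℕ → ℕ∞)).subset fun x hx => ?_
    obtain ⟨n, rfl⟩ := ENat.ne_top_iff_exists.mp (ne_top_of_le_ne_top (ENat.natCast_ne_top B) hx)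
    exact ⟨n, by simpa using hx, rfl⟩
  have hT : (insert ⊤ (Set.Iic (B : ℕ∞))).Finite := hB.insert ⊤
  refine (Set.finite_univ.prod (((hT.prod hT).image some).insert none)).subset ?_
  rintro _ ⟨⟨x, _ | v⟩, hg, rfl⟩
  · simp [NamedGap.shape]
  · rcases hG _ hg v rfl with h | h
    · simp [NamedGap.shape, h.1, h.2]
    · simp [NamedGap.shape, h.1, h.2]

theorem GoodSet.exists_subseq_const_or_strict {Var : Type u} [Finite Var] (star : Var) {B : ℕ}
    {G : Set (NamedGap Var)} (hG : GoodSet B G) (g : ℕ → NamedGap Var) (hg : ∀ n, g n ∈ G) :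
    ∃ φ : ℕ → ℕ, StrictMono φ ∧ ((∀ l m, g (φ l) = g (φ m)) ∨
      ∀ l m, l < m → gapLe star (g (φ l)) (g (φ m)) ∧ ¬ gapLe star (g (φ m)) (g (φ l))) := by
  obtain ⟨φ, hφ, hs⟩ := exists_strictMono_comp_eq_of_finite_range (fun n => NamedGap.shape (g n))
    (hG.finite_image_shape.subset (Set.range_subset_iff.2 fun n => ⟨g n, hg n, rfl⟩))
  obtain ⟨ψ, hψ, hl⟩ :=
    exists_strictMono_comp_const_or_strictMono (fun n => NamedGap.lower (g (φ n)))
  refine ⟨φ ∘ ψ, hφ.comp hψ, hl.imp (fun h l m => ?_) fun h l m hlm => ?_⟩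
  · exact NamedGap.ext_of_shape_lower (hs _ _) (h l m)
  · have hlt := h hlm
    exact ⟨(gapLe_iff_lower_le star (hs _ _)).2 hlt.le,
      fun hle => hlt.not_ge ((gapLe_iff_lower_le star (hs _ _)).1 hle)⟩

/-- Every infinite sequence of task states over a good set of
named gaps admits an infinite subsequence that is `≼`-monotone, has a constant
`UnrSuff` component, and whose gap component in each coordinate is either
constant or strictly `⊴`-increasing. -/
theorem taskStates_monotone_subsequence {Var : Type u} {UnrSuff : Type v}
    [Fintype Var] [Fintype UnrSuff] (star : Var) (starU : UnrSuff) (K : ℕ)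
    (G : Set (NamedGap Var)) (hG : ∃ B : ℕ, GoodSet B G)
    (a : ℕ → TaskState UnrSuff Var K) (ha : ∀ n k, (a n).2 k ∈ G) :
    ∃ idx : ℕ → ℕ, StrictMono idx ∧
      (∀ l m, l < m → taskLe starU star (a (idx l)) (a (idx m))) ∧
      (∀ n, (a (idx n)).1 = (a (idx 0)).1) ∧
      (∀ k : Fin K,
        (∀ l m, (a (idx l)).2 k = (a (idx m)).2 k) ∨
        (∀ l m, l < m → gapLe star ((a (idx l)).2 k) ((a (idx m)).2 k) ∧
          ¬ gapLe star ((a (idx m)).2 k) ((a (idx l)).2 k))) := by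
  obtain ⟨B, hB⟩ := hG
  obtain ⟨φ, hφ, hc⟩ := exists_strictMono_comp_eq_of_finite_range (fun n => (a n).1)
    (Set.toFinite _)
  obtain ⟨ψ, hψ, hP⟩ := exists_strictMono_forall_of_hereditary
    (fun (k : Fin K) (idx : ℕ → ℕ) =>
      (∀ l m, (a (idx l)).2 k = (a (idx m)).2 k) ∨
      (∀ l m, l < m → gapLe star ((a (idx l)).2 k) ((a (idx m)).2 k) ∧
        ¬ gapLe star ((a (idx m)).2 k) ((a (idx l)).2 k)))
    (fun k φ ψ hψ h => h.imp (fun h l m => h _ _) fun h l m hlm => h _ _ (hψ hlm))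
    (fun k φ => hB.exists_subseq_const_or_strict star (fun n => (a (φ n)).2 k) fun n => ha _ k)
    φ
  refine ⟨φ ∘ ψ, hφ.comp hψ, fun l m hlm => ⟨fun hne => absurd (hc _ _) hne, fun k => ?_⟩,
    fun n => hc _ _, hP⟩
  rcases hP k with h | h
  · rw [h l m]
    exact gapLe_refl star _
  · exact (h l m hlm).1
end

section
/- For constraints φ_a and φ_b, if φ_a ⊑ φ_b (φ_a is entailed by φ_b), then every configuration denoted by φ_b is also denoted by φ_a, i.e., ⟦φ_b⟧ ⊆ ⟦φ_a⟧. -/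
universe u v w

theorem Finset.image_comp_filter_mem {α β γ : Type*} [DecidableEq β] [DecidableEq γ]
    {A : Finset α} {C : Finset β} {f : α → β} (g : β → γ) (hC : C ⊆ A.image f) :
    (A.filter (f · ∈ C)).image (g ∘ f) = C.image g := by
  rw [← Finset.image_image, ← Finset.filter_image (p := (· ∈ C)),
    Finset.filter_mem_eq_inter, Finset.inter_eq_right.2 hC]

/-- If `φa ⊑ φb` then every configuration denoted by `φb` is also
denoted by `φa`, i.e., `⟦φb⟧ ⊆ ⟦φa⟧`. -/
theorem entails_denotation_subset {BV : Type u} {Var : Type v} {UnrSuff : Type w}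
    (star : Var) (starU : UnrSuff) (φa φb : Constraint BV Var UnrSuff)
    (h : Entails star starU φa φb) :
    Denotation star starU φb ⊆ Denotation star starU φa := by
  rintro c ⟨hcbv, T, hT, P, hP, τ, π, hτ, hπinj, hπ, hcseq, hc⟩
  obtain ⟨hbv, T', hT', P', hP', τ', π', hτ', hπ'inj, hπ', hseq, hφ⟩ := h
  refine ⟨fun b hb => ?_, T.filter (τ · ∈ T'), (Finset.filter_subset _ _).trans hT,
    P.filter (π · ∈ P'), (Finset.filter_subset _ _).trans hP, τ' ∘ τ, π' ∘ π,
    (Finset.image_comp_filter_mem _ (hT'.trans hτ.ge)).trans hτ', ?_,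
    (Finset.image_comp_filter_mem _ (hP'.trans hπ.ge)).trans hπ', fun t ht hne => ?_, fun p hp => ?_⟩
  · by_cases hab : φa.bv b = φb.bv b
    · rw [hab] at hb ⊢
      exact hcbv b hb
    · exact hbv b hab
  · refine hπ'inj.comp (hπinj.mono ?_) ?_
    · exact Finset.coe_subset.2 (Finset.filter_subset _ _)
    · intro p hp
      exact (Finset.mem_filter.1 hp).2
  · obtain ⟨htT, htT'⟩ := Finset.mem_filter.1 ht
    simp only [Function.comp_apply] at hne ⊢
    by_cases hab : φa.seq (τ' (τ t)) = φb.seq (τ t)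
    · rw [hab] at hne ⊢
      exact hcseq t htT hne
    · exact hseq _ htT' hab
  · obtain ⟨hpP, hpP'⟩ := Finset.mem_filter.1 hp
    obtain ⟨l, hreg, henv⟩ := hc p hpP
    obtain ⟨⟨hew, hes⟩, hgap, hfree⟩ := hφ _ hpP'
    simp only [Function.comp_apply]
    refine ⟨l, fun t ht => ?_, fun t htc ht w s hws => ?_⟩
    · obtain ⟨htT, htT'⟩ := Finset.mem_filter.1 ht
      obtain ⟨hvar, hnone, hval⟩ := hreg t htT
      obtain ⟨hvar', hnone', hval'⟩ := hgap _ htT'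
      refine ⟨fun hne => ?_, hnone.trans hnone'.symm, fun w s v hws hv => ?_⟩
      · by_cases hab : (φa.gap (τ' (τ t)) (π' (π p))).1 = (φb.gap (τ t) (π p)).1
        · rw [hab] at hne ⊢
          exact hvar hne
        · exact hvar' hab
      · obtain ⟨v', hv'⟩ : ∃ v', (φb.gap (τ t) (π p)).2 = some v' :=
          Option.ne_none_iff_exists'.1 fun h => by simp [hnone'.2 h] at hv
        obtain ⟨h₁, h₂, h₃, h₄⟩ := hval w s v' hws hv'
        obtain ⟨k₁, k₂, k₃, k₄⟩ := hval' v v' hv hv'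
        exact ⟨by lia, h₂.trans k₃, by lia, h₄.trans k₄⟩
    · by_cases htT : t ∈ T
      · have htT' : τ t ∉ T' := fun h => ht (Finset.mem_filter.2 ⟨htT, h⟩)
        obtain ⟨-, hnone, hval⟩ := hreg t htT
        obtain ⟨v, hv⟩ : ∃ v, (φb.gap (τ t) (π p)).2 = some v :=
          Option.ne_none_iff_exists'.1 fun h => by simp [hnone.2 h] at hws
        obtain ⟨h₁, -, h₂, -⟩ := hval w s v hws hv
        obtain ⟨k₁, k₂⟩ := hfree _ (hτ ▸ Finset.mem_image_of_mem τ htT) htT' v hv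
        lia
      · have := henv t htc htT w s hws
        lia
end
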